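/- Let z ∈ t_Q satisfy γ(z) ∈ {-1, 0, 1, 2} for all γ ∈ Δ⁺, and let w_z ∈ W be the unique element with inversion set N(w_z) = Δ⁺_z(1) ∪ Δ⁺_z(2). Then: (i) if γ ∈ Δ⁺_z(0) is not a sum of two roots from Δ⁺_z(0), then w_z(γ) ∈ Π; (ii) if θ(z) = 1, then w_z(θ) ∈ -Π. -/

import Mathlib

open scoped RealInnerProductSpace

attribute [local instance] Classical.propDecidable

section RootCombinatorics

variable {V : Type*} [NormedAddCommGroup V] [InnerProductSpace ℝ V]

/-- The Cartan pairing `⟨γ, α∨⟩ = 2 (γ, α) / (α, α)`. -/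
noncomputable def cartanPairing (γ α : V) : ℝ := 2 * ⟪γ, α⟫ / ⟪α, α⟫

/-- The coroot `γ∨ = 2 γ / (γ, γ)`. -/
noncomputable def covec (γ : V) : V := (2 / ⟪γ, γ⟫) • γ

/-- The cascade element `x_K = Σ_{β ∈ K} β / (β, β) = ½ Σ_{β ∈ K} β∨`. -/
noncomputable def cascElt (K : Finset V) : V := ∑ β ∈ K, (⟪β, β⟫)⁻¹ • β

/-- The roots of `S` orthogonal to `β`. -/
noncomputable def orthSub (S : Finset V) (β : V) : Finset V := S.filter fun γ => ⟪γ, β⟫ = 0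

/-- One step of the non-orthogonality (connectedness) relation inside `S`. -/
def connRel (S : Finset V) (a b : V) : Prop := a ∈ S ∧ b ∈ S ∧ ⟪a, b⟫ ≠ 0

/-- The irreducible component of the root subsystem `S` containing `γ`. -/
noncomputable def component (S : Finset V) (γ : V) : Finset V :=
  S.filter fun γ' => Relation.ReflTransGen (connRel S) γ γ'

/-- `C` is an irreducible component of the root subsystem `S`. -/
def IsComponent (S C : Finset V) : Prop := ∃ γ ∈ S, C = component S γ

end RootCombinatorics

/-- The combinatorial data of an irreducible crystallographic root system with a chosen
system of positive roots, base (set of simple roots) and highest root: the combinatorial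
skeleton of a finite-dimensional complex simple Lie algebra, with the Killing-form
identification of the Cartan subalgebra and its dual. -/
structure RootSystemCtx (V : Type*) [NormedAddCommGroup V] [InnerProductSpace ℝ V] where
  /-- the set of roots Δ -/
  Δ : Finset V
  /-- the set of simple roots Π -/
  base : Finset V
  /-- the set of positive roots Δ⁺ -/
  Pos : Finset V
  /-- the highest root θ -/
  θ : V
  zero_not_mem : (0 : V) ∉ Δ
  neg_mem : ∀ γ ∈ Δ, -γ ∈ Δ
  reflect_mem : ∀ α ∈ Δ, ∀ γ ∈ Δ, γ - cartanPairing γ α • α ∈ Δ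
  pairing_int : ∀ α ∈ Δ, ∀ γ ∈ Δ, ∃ k : ℤ, cartanPairing γ α = (k : ℝ)
  span_eq : Submodule.span ℝ (Δ : Set V) = ⊤
  base_subset : base ⊆ Pos
  base_indep : LinearIndependent ℝ (fun a : {x // x ∈ base} => (a : V))
  pos_subset : Pos ⊆ Δ
  pos_or_neg : ∀ γ ∈ Δ, γ ∈ Pos ∨ -γ ∈ Pos
  pos_not_neg : ∀ γ ∈ Pos, -γ ∉ Pos
  pos_coords : ∀ γ ∈ Pos, γ ∈ AddSubmonoid.closure (base : Set V)
  irreducible : ∀ S : Finset V, S ⊆ Δ → S.Nonempty →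
    (∀ a ∈ S, ∀ b ∈ Δ, b ∉ S → ⟪a, b⟫ = 0) → S = Δ
  theta_mem : θ ∈ Pos
  theta_highest : ∀ γ ∈ Δ, θ - γ ∈ AddSubmonoid.closure (base : Set V)

namespace RootSystemCtx

variable {V : Type*} [NormedAddCommGroup V] [InnerProductSpace ℝ V]

variable (ctx : RootSystemCtx V)

/-- The root order `γ ≼ γ'` on roots: `γ' - γ` is a nonnegative integral combination of
simple roots. -/
def rootLE (γ γ' : V) : Prop := γ' - γ ∈ AddSubmonoid.closure (ctx.base : Set V)

/-- `β` is the highest root of the root subsystem `S` (with respect to the ambient positive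
system). -/
def IsHighest (S : Finset V) (β : V) : Prop :=
  β ∈ S ∧ β ∈ ctx.Pos ∧ ∀ γ ∈ S, ctx.rootLE γ β

/-- `CascadeMem ctx S β` : the pair (root subsystem `S = Δ⟨i⟩`, its highest root `β = βᵢ`)
occurs in the recursive construction of the Kostant cascade: one starts with `(Δ, θ)`, and the
descendants of `(S, β)` are the pairs `(C, β')` where `C` is an irreducible component of
`{γ ∈ S | (γ, β) = 0}` and `β'` is the highest root of `C`. -/
inductive CascadeMem : Finset V → V → Prop
  | top : CascadeMem ctx.Δ ctx.θ
  | step {S C : Finset V} {β β' : V} : CascadeMem S β →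
      IsComponent (orthSub S β) C → ctx.IsHighest C β' → CascadeMem C β'

/-- `K` is the Kostant cascade of the root system. -/
def IsCascade (K : Finset V) : Prop := ∀ β, β ∈ K ↔ ∃ S, ctx.CascadeMem S β

/-- The Heisenberg subset `H_β = {γ ∈ S ∩ Δ⁺ : (γ, β) > 0}` attached to a cascade pair
`(S, β)`. -/
noncomputable def heis (S : Finset V) (β : V) : Finset V :=
  S.filter fun γ => γ ∈ ctx.Pos ∧ 0 < ⟪γ, β⟫

/-- A root is long if it has the same length as the highest root. -/
def IsLong (γ : V) : Prop := ⟪γ, γ⟫ = ⟪ctx.θ, ctx.θ⟫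

/-- The highest root `θ` is a fundamental weight. -/
def ThetaFundamental : Prop :=
  ∃ α ∈ ctx.base, cartanPairing ctx.θ α = 1 ∧
    ∀ β ∈ ctx.base, β ≠ α → cartanPairing ctx.θ β = 0

/-- `β'` is a descendant of the cascade element `β`. -/
def Desc (β β' : V) : Prop :=
  ∃ S C, ctx.CascadeMem S β ∧ IsComponent (orthSub S β) C ∧ ctx.IsHighest C β'

/-- The cascade poset order: `β ≤ β'` iff `β` is an iterated descendant of `β'`. -/
def cascLE (β β' : V) : Prop := Relation.ReflTransGen (fun a b => ctx.Desc b a) β β'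

/-- A simple reflection of the root system. -/
def IsSimpleReflection (w : V ≃ₗ[ℝ] V) : Prop :=
  ∃ α ∈ ctx.base, ∀ v, w v = v - (2 * ⟪v, α⟫ / ⟪α, α⟫) • α

/-- The Weyl group, generated by the simple reflections. -/
def weylGroup : Subgroup (V ≃ₗ[ℝ] V) := Subgroup.closure {w | ctx.IsSimpleReflection w}

/-- The length of a Weyl group element: the minimal number of simple reflections needed to
express it. -/
noncomputable def length (w : V ≃ₗ[ℝ] V) : ℕ :=
  sInf {n | ∃ l : List (V ≃ₗ[ℝ] V), l.length = n ∧
    (∀ s ∈ l, ctx.IsSimpleReflection s) ∧ l.prod = w}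

/-- The root system is of type `Aₙ` (Cartan matrix characterisation). -/
def IsTypeA (n : ℕ) : Prop :=
  1 ≤ n ∧ ∃ e : Fin n ≃ {x // x ∈ ctx.base}, ∀ i j : Fin n,
    cartanPairing (e i : V) (e j : V) =
      (if i = j then 2 else if i.val + 1 = j.val ∨ j.val + 1 = i.val then -1 else 0)

/-- The root system is of type `Bₙ` (`n ≥ 2`), with the last simple root short. -/
def IsTypeB (n : ℕ) : Prop :=
  2 ≤ n ∧ ∃ e : Fin n ≃ {x // x ∈ ctx.base}, ∀ i j : Fin n,
    cartanPairing (e i : V) (e j : V) =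
      (if i = j then 2
       else if i.val + 2 = n ∧ j.val + 1 = n then -2
       else if i.val + 1 = j.val ∨ j.val + 1 = i.val then -1 else 0)

/-- The root system is of type `Cₙ` (`n ≥ 2`), with the last simple root long. -/
def IsTypeC (n : ℕ) : Prop :=
  2 ≤ n ∧ ∃ e : Fin n ≃ {x // x ∈ ctx.base}, ∀ i j : Fin n,
    cartanPairing (e i : V) (e j : V) =
      (if i = j then 2
       else if i.val + 1 = n ∧ j.val + 2 = n then -2
       else if i.val + 1 = j.val ∨ j.val + 1 = i.val then -1 else 0)

/-- The root system is of type `G₂` (first simple root short). -/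
def IsTypeG2 : Prop :=
  ∃ e : Fin 2 ≃ {x // x ∈ ctx.base},
    cartanPairing (e 0 : V) (e 0 : V) = 2 ∧ cartanPairing (e 1 : V) (e 1 : V) = 2 ∧
    cartanPairing (e 0 : V) (e 1 : V) = -1 ∧ cartanPairing (e 1 : V) (e 0 : V) = -3

/-- The set of roots `Δ(a_z) = w(Δ⁺_z(-1)) ∪ w(-Δ⁺_z(2))` of the abelian ideal attached by
Kostant's construction to `z` (with `w = w_z`). -/
def idealSet (w : V ≃ₗ[ℝ] V) (x : V) : Set V :=
  {δ | ∃ γ ∈ ctx.Pos, (⟪γ, x⟫ = -1 ∧ δ = w γ) ∨ (⟪γ, x⟫ = 2 ∧ δ = -(w γ))}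

end RootSystemCtx

namespace RootSystemCtx

variable {V : Type*} [NormedAddCommGroup V] [InnerProductSpace ℝ V]

variable (ctx : RootSystemCtx V)

theorem isSimpleReflection_mem_iff {w : V ≃ₗ[ℝ] V} (hw : ctx.IsSimpleReflection w) (v : V) :
    w v ∈ ctx.Δ ↔ v ∈ ctx.Δ := by
  obtain ⟨α, hα, h⟩ := hw
  have hαΔ := ctx.pos_subset (ctx.base_subset hα)
  have hα0 : α ≠ 0 := fun h0 => ctx.zero_not_mem (h0 ▸ hαΔ)
  have hwΔ : ∀ u ∈ ctx.Δ, w u ∈ ctx.Δ := fun u hu => by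
    rw [h]
    exact ctx.reflect_mem α hαΔ u hu
  refine ⟨fun hv => ?_, hwΔ v⟩
  have hsq : w (w v) = v := by
    have hαα : ⟪α, α⟫ ≠ 0 := inner_self_ne_zero.2 hα0
    have hc : 2 * ⟪v - (2 * ⟪v, α⟫ / ⟪α, α⟫) • α, α⟫ / ⟪α, α⟫ = -(2 * ⟪v, α⟫ / ⟪α, α⟫) := by
      rw [inner_sub_left, real_inner_smul_left]
      field_simp
      ring
    rw [h (w v), h v, hc]
    module
  exact hsq ▸ hwΔ _ hv

theorem weylGroup_mem_iff {w : V ≃ₗ[ℝ] V} (hw : w ∈ ctx.weylGroup) :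
    ∀ v : V, w v ∈ ctx.Δ ↔ v ∈ ctx.Δ := by
  induction hw using Subgroup.closure_induction with
  | mem w hw => exact ctx.isSimpleReflection_mem_iff hw
  | one => exact fun _ => Iff.rfl
  | mul x y _ _ hx hy => exact fun v => (hx (y v)).trans (hy v)
  | inv x _ hx =>
    intro v
    rw [← hx (x⁻¹ v)]
    exact iff_of_eq (congrArg (· ∈ ctx.Δ) (x.apply_symm_apply v))

/-- Heights of roots extend to a linear functional. -/
theorem exists_height : ∃ h : V →ₗ[ℝ] ℝ, (∀ α ∈ ctx.base, h α = 1) ∧ ∀ γ ∈ ctx.Pos, 1 ≤ h γ := by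
  let b := Module.Basis.extend ctx.base_indep.linearIndepOn_id
  have hb : ∀ α ∈ ctx.base, b.constr ℝ (fun _ => (1 : ℝ)) α = 1 := by
    intro α hα
    have hmem := ctx.base_indep.linearIndepOn_id.subset_extend (Set.subset_univ _)
      (Set.mem_range.2 ⟨⟨α, hα⟩, rfl⟩)
    simpa [b] using b.constr_basis ℝ (fun _ => (1 : ℝ)) ⟨α, hmem⟩
  refine ⟨b.constr ℝ fun _ => 1, hb, fun γ hγ => ?_⟩
  have key : ∀ v ∈ AddSubmonoid.closure (ctx.base : Set V),
      v = 0 ∨ 1 ≤ b.constr ℝ (fun _ => (1 : ℝ)) v := by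
    intro v hv
    induction hv using AddSubmonoid.closure_induction with
    | mem v hv => exact Or.inr (hb v hv).ge
    | zero => exact Or.inl rfl
    | add x y _ _ hx hy =>
      rcases hx with rfl | hx
      · simpa using hy
      · rcases hy with rfl | hy
        · simpa using Or.inr hx
        · right
          rw [map_add]
          linarith
  exact (key γ (ctx.pos_coords γ hγ)).resolve_left fun h0 =>
    ctx.zero_not_mem (h0 ▸ ctx.pos_subset hγ)

theorem sub_mem_of_inner_pos {γ α : V} (hγ : γ ∈ ctx.Δ) (hα : α ∈ ctx.Δ) (hne : γ ≠ α)
    (hpos : 0 < ⟪γ, α⟫) : γ - α ∈ ctx.Δ := by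
  have hγγ : 0 < ⟪γ, γ⟫ := real_inner_self_pos.2 fun h => ctx.zero_not_mem (h ▸ hγ)
  have hαα : 0 < ⟪α, α⟫ := real_inner_self_pos.2 fun h => ctx.zero_not_mem (h ▸ hα)
  obtain ⟨m, hm⟩ := ctx.pairing_int α hα γ hγ
  obtain ⟨n, hn⟩ := ctx.pairing_int γ hγ α hα
  have hm' : 2 * ⟪γ, α⟫ = m * ⟪α, α⟫ := by
    rw [← hm, cartanPairing]; field_simp
  have hn' : 2 * ⟪γ, α⟫ = n * ⟪γ, γ⟫ := by
    rw [← hn, cartanPairing, real_inner_comm]; field_simp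
  have hm0 : 0 < m := by
    have : (0 : ℝ) < m := pos_of_mul_pos_left (hm' ▸ by positivity) hαα.le
    exact_mod_cast this
  have hn0 : 0 < n := by
    have : (0 : ℝ) < n := pos_of_mul_pos_left (hn' ▸ by positivity) hγγ.le
    exact_mod_cast this
  have hmn : m * n ≤ 4 := by
    have hcs := real_inner_mul_inner_self_le γ α
    have h4 : ((m : ℝ) * n) * (⟪γ, γ⟫ * ⟪α, α⟫) = 4 * (⟪γ, α⟫ * ⟪γ, α⟫) := by
      linear_combination (-(n : ℝ) * ⟪γ, γ⟫) * hm' - 2 * ⟪γ, α⟫ * hn'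
    have : (m : ℝ) * n ≤ 4 := by
      refine le_of_mul_le_mul_right ?_ (mul_pos hγγ hαα)
      linarith
    exact_mod_cast this
  by_cases hm1 : m = 1
  · simpa [hm, hm1] using ctx.reflect_mem α hα γ hγ
  by_cases hn1 : n = 1
  · simpa [hn, hn1] using ctx.neg_mem _ (ctx.reflect_mem γ hγ α hα)
  exfalso
  have hm2 : m = 2 := by nlinarith [show 2 ≤ m by omega, show 2 ≤ n by omega]
  have hn2 : n = 2 := by nlinarith [show 2 ≤ n by omega]
  subst hm2 hn2
  push_cast at hm' hn'
  refine hne (sub_eq_zero.1 (inner_self_eq_zero (𝕜 := ℝ).1 ?_))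
  rw [real_inner_sub_sub_self]
  linarith

theorem exists_base_inner_pos {γ : V} (hγ : γ ∈ ctx.Pos) : ∃ α ∈ ctx.base, 0 < ⟪γ, α⟫ := by
  by_contra! hcon
  have key : ∀ v ∈ AddSubmonoid.closure (ctx.base : Set V), ⟪γ, v⟫ ≤ 0 := by
    intro v hv
    induction hv using AddSubmonoid.closure_induction with
    | mem v hv => exact hcon v hv
    | zero => simp
    | add x y _ _ hx hy =>
      rw [inner_add_right]
      linarith
  exact (key γ (ctx.pos_coords γ hγ)).not_gt
    (real_inner_self_pos.2 fun h => ctx.zero_not_mem (h ▸ ctx.pos_subset hγ))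

theorem exists_add_of_not_mem_base {γ : V} (hγ : γ ∈ ctx.Pos) (hb : γ ∉ ctx.base) :
    ∃ γ₁ ∈ ctx.Pos, ∃ γ₂ ∈ ctx.Pos, γ = γ₁ + γ₂ := by
  obtain ⟨α, hα, hpos⟩ := ctx.exists_base_inner_pos hγ
  have hαP := ctx.base_subset hα
  refine ⟨α, hαP, γ - α, ?_, by abel⟩
  have hne : γ ≠ α := fun h => hb (h ▸ hα)
  refine (ctx.pos_or_neg _ (ctx.sub_mem_of_inner_pos (ctx.pos_subset hγ)
    (ctx.pos_subset hαP) hne hpos)).resolve_right fun hneg => ?_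
  obtain ⟨h, hbase, hP⟩ := ctx.exists_height
  have h₁ := hP _ hneg
  have h₂ := hP γ hγ
  rw [map_neg, map_sub, hbase α hα] at h₁
  linarith

theorem theta_add_not_mem {γ : V} (hγ : γ ∈ ctx.Pos) : ctx.θ + γ ∉ ctx.Δ := by
  intro hmem
  obtain ⟨h, hbase, hP⟩ := ctx.exists_height
  have key : ∀ v ∈ AddSubmonoid.closure (ctx.base : Set V), 0 ≤ h v := by
    intro v hv
    induction hv using AddSubmonoid.closure_induction with
    | mem v hv => exact (hbase v hv).ge.trans' zero_le_one
    | zero => simp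
    | add x y _ _ hx hy =>
      rw [map_add]
      linarith
  have h₁ := key _ (ctx.theta_highest _ hmem)
  have h₂ := hP γ hγ
  rw [map_sub, map_add] at h₁
  linarith

/-- The `z`-values of the preimages of positive roots under `w_z` are `0`, `-1` or `-2`, and the
value `0` is attained only at positive preimages. -/
theorem inner_symm_of_mem_pos {z : V}
    (hz : ∀ γ ∈ ctx.Pos, ⟪γ, z⟫ = -1 ∨ ⟪γ, z⟫ = 0 ∨ ⟪γ, z⟫ = 1 ∨ ⟪γ, z⟫ = 2)
    {w : V ≃ₗ[ℝ] V} (hw : w ∈ ctx.weylGroup)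
    (hN : ∀ γ ∈ ctx.Pos, (-(w γ) ∈ ctx.Pos ↔ (⟪γ, z⟫ = 1 ∨ ⟪γ, z⟫ = 2)))
    {μ : V} (hμ : μ ∈ ctx.Pos) :
    (⟪w.symm μ, z⟫ = 0 ∧ w.symm μ ∈ ctx.Pos) ∨ ⟪w.symm μ, z⟫ = -1 ∨ ⟪w.symm μ, z⟫ = -2 := by
  have hΔ : w.symm μ ∈ ctx.Δ := by
    rw [← ctx.weylGroup_mem_iff hw, w.apply_symm_apply]
    exact ctx.pos_subset hμ
  rcases ctx.pos_or_neg _ hΔ with hp | hp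
  · have hnot : ¬ (⟪w.symm μ, z⟫ = 1 ∨ ⟪w.symm μ, z⟫ = 2) := by
      rw [← hN _ hp, w.apply_symm_apply]
      exact ctx.pos_not_neg μ hμ
    have := hz _ hp
    tauto
  · have hmem := (hN _ hp).1 (by simpa using hμ)
    rw [inner_neg_left] at hmem
    right
    rcases hmem with h | h
    · left; linarith
    · right; linarith

end RootSystemCtx

/-- Kostant's construction: if `γ(z) ∈ {-1,0,1,2}` for all positive roots and `w_z` is the
Weyl group element with inversion set `Δ⁺_z(1) ∪ Δ⁺_z(2)`, then (i) `w_z` maps each root of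
the base of `Δ_z(0)` to a simple root, and (ii) if `θ(z) = 1` then `w_z(θ) ∈ -Π`. -/
theorem w_z_properties {V : Type*} [NormedAddCommGroup V] [InnerProductSpace ℝ V]
    [FiniteDimensional ℝ V] (ctx : RootSystemCtx V)
    (z : V)
    (hz : ∀ γ ∈ ctx.Pos, ⟪γ, z⟫ = -1 ∨ ⟪γ, z⟫ = 0 ∨ ⟪γ, z⟫ = 1 ∨ ⟪γ, z⟫ = 2)
    (w : V ≃ₗ[ℝ] V) (hw : w ∈ ctx.weylGroup)
    (hN : ∀ γ ∈ ctx.Pos, (-(w γ) ∈ ctx.Pos ↔ (⟪γ, z⟫ = 1 ∨ ⟪γ, z⟫ = 2))) :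
    (∀ γ ∈ ctx.Pos, ⟪γ, z⟫ = 0 →
      (¬ ∃ γ₁ ∈ ctx.Pos, ∃ γ₂ ∈ ctx.Pos, ⟪γ₁, z⟫ = 0 ∧ ⟪γ₂, z⟫ = 0 ∧ γ = γ₁ + γ₂) →
      w γ ∈ ctx.base) ∧
    (⟪ctx.θ, z⟫ = 1 → -(w ctx.θ) ∈ ctx.base) := by
  refine ⟨fun γ hγ h0 hind => ?_, fun hθ => ?_⟩
  · have hwγ : w γ ∈ ctx.Pos := by
      refine (ctx.pos_or_neg _ ((ctx.weylGroup_mem_iff hw γ).2 (ctx.pos_subset hγ))).resolve_right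
        fun hneg => ?_
      rcases (hN γ hγ).1 hneg with h | h <;> linarith
    by_contra hb
    obtain ⟨μ₁, hμ₁, μ₂, hμ₂, hsum⟩ := ctx.exists_add_of_not_mem_base hwγ hb
    have hγsum : γ = w.symm μ₁ + w.symm μ₂ := by
      rw [← map_add, ← hsum, w.symm_apply_apply]
    rw [hγsum, inner_add_left] at h0
    obtain h₁ | h₁ | h₁ := ctx.inner_symm_of_mem_pos hz hw hN hμ₁ <;>
    obtain h₂ | h₂ | h₂ := ctx.inner_symm_of_mem_pos hz hw hN hμ₂
    · exact hind ⟨_, h₁.2, _, h₂.2, h₁.1, h₂.1, hγsum⟩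
    all_goals grind
  · have hwθ : -(w ctx.θ) ∈ ctx.Pos := (hN _ ctx.theta_mem).2 (Or.inl hθ)
    by_contra hb
    obtain ⟨μ₁, hμ₁, μ₂, hμ₂, hsum⟩ := ctx.exists_add_of_not_mem_base hwθ hb
    have hθsum : -ctx.θ = w.symm μ₁ + w.symm μ₂ := by
      rw [← map_add, ← hsum, map_neg, w.symm_apply_apply]
    have hnot : ∀ μ ν : V, ν ∈ ctx.Pos → -ctx.θ = w.symm μ + w.symm ν → w.symm μ ∉ ctx.Pos := by
      intro μ ν hν h hμ
      refine ctx.theta_add_not_mem hμ ?_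
      have hν' : ctx.θ + w.symm μ = -w.symm ν := by
        rw [← neg_neg ctx.θ, h]
        abel
      rw [hν']
      refine ctx.neg_mem _ ((ctx.weylGroup_mem_iff hw _).1 ?_)
      rw [w.apply_symm_apply]
      exact ctx.pos_subset hν
    have hval := congrArg (fun v => ⟪v, z⟫) hθsum
    simp only [inner_neg_left, inner_add_left, hθ] at hval
    have hn₁ := hnot μ₁ μ₂ hμ₂ hθsum
    have hn₂ := hnot μ₂ μ₁ hμ₁ (hθsum.trans (add_comm _ _))
    obtain h₁ | h₁ | h₁ := ctx.inner_symm_of_mem_pos hz hw hN hμ₁ <;>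
    obtain h₂ | h₂ | h₂ := ctx.inner_symm_of_mem_pos hz hw hN hμ₂ <;>
    grind
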